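/- arXiv:1111.3160 — 5 statements merged into one kernel-verified Lean document; each statement's English description precedes it below -/
import Mathlib

section
/- Let L ≥ 2, K ≥ 1, and β ≥ 1 be integers, and set M = β and N = LKβ. Then min( KLM, LN, (KL/(K+L−1))·max(KM, (L−1)N), (KL/(K+L−1))·max((L−1)M, N) ) = KLβ, where the minimum and maximum are taken over real numbers. In particular KL ≥ K + L − 1 for all integers K, L ≥ 1. -/
/-- Converse for receive zero forcing in the `L`-cell `K`-user MIMO MAC: with `M = β`
and `N = LKβ`, the degrees of freedom outer bound
`min(KLM, LN, (KL/(K+L−1))·max(KM,(L−1)N), (KL/(K+L−1))·max((L−1)M,N))` equals `KLβ`.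
In particular `KL ≥ K + L − 1` for all integers `K, L ≥ 1`. -/
theorem L_cell_outer_bound_eq_KL_beta
    (L K β : ℕ) (hL : 2 ≤ L) (hK : 1 ≤ K) (hβ : 1 ≤ β) :
    (∀ M N : ℝ, M = β → N = L * K * β →
      min (min ((K : ℝ) * L * M) (L * N))
        (min ((K * L / (K + L - 1)) * max (K * M) ((L - 1) * N))
          ((K * L / (K + L - 1)) * max ((L - 1) * M) N))
        = K * L * β) ∧
    (∀ K' L' : ℕ, 1 ≤ K' → 1 ≤ L' → K' + L' - 1 ≤ K' * L') := by
  constructor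
  · intro M N hM hN
    have hL' : (2 : ℝ) ≤ L := by exact_mod_cast hL
    have hK' : (1 : ℝ) ≤ K := by exact_mod_cast hK
    have hb : (1 : ℝ) ≤ β := by exact_mod_cast hβ
    have hd : (0 : ℝ) < K + L - 1 := by linarith
    have hKL : (K : ℝ) + L - 1 ≤ L * K := by nlinarith
    have hN1 : ((K : ℝ) + L - 1) * β ≤ N := by
      rw [hN]; exact mul_le_mul_of_nonneg_right hKL (by linarith)
    have hN0 : 0 ≤ N := le_trans (by positivity) hN1
    have key : ∀ x : ℝ, N ≤ x → (K : ℝ) * L * β ≤ (K * L / (K + L - 1)) * x := by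
      intro x hx
      have h1 : (K : ℝ) * L * β = (K * L / (K + L - 1)) * ((K + L - 1) * β) := by
        field_simp
      rw [h1]
      exact mul_le_mul_of_nonneg_left (hN1.trans hx) (by positivity)
    have h2 : (K : ℝ) * L * β ≤ L * N := by
      have : (K : ℝ) * L * β = N := by rw [hN]; ring
      rw [this]; nlinarith
    have h3 := key (max (K * M) ((L - 1) * N)) (le_max_of_le_right (by nlinarith))
    have h4 := key (max ((L - 1) * M) N) (le_max_right _ _)
    rw [hM] at h3 h4 ⊢
    rw [min_eq_left h2, min_eq_left (le_min h3 h4)]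
  · intro K' L' h1 h2
    obtain ⟨a, rfl⟩ := Nat.exists_eq_add_of_le h1
    obtain ⟨b, rfl⟩ := Nat.exists_eq_add_of_le h2
    have : (1 + a) * (1 + b) = 1 + a + b + a * b := by ring
    rw [this]
    omega
end

section
/- Let m, n, l be positive integers with n ≥ max(m, l). Then the set of pairs (A, B) ∈ ℂ^{m×n} × ℂ^{n×l} such that rank(A·B) < min(m, l) has Lebesgue measure zero, where ℂ^{m×n} × ℂ^{n×l} is identified with ℝ^{2mn+2nl} and equipped with Lebesgue measure. -/
open MeasureTheory Matrix

def topMinor (m n l : ℕ) (p : (Fin m → Fin n → ℂ) × (Fin n → Fin l → ℂ)) : ℂ :=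
  ((Matrix.of p.1 * Matrix.of p.2).submatrix
    (Fin.castLE (min_le_left m l)) (Fin.castLE (min_le_right m l))).det

lemma topMinor_cont (m n l : ℕ) : Continuous (topMinor m n l) := by
  unfold topMinor
  apply Continuous.matrix_det
  apply Continuous.matrix_submatrix
  apply Continuous.matrix_mul
  · exact continuous_fst
  · exact continuous_snd

lemma rank_of_topMinor (m n l : ℕ) (p) (h : topMinor m n l p ≠ 0) :
    min m l ≤ (Matrix.of p.1 * Matrix.of p.2).rank := by
  unfold topMinor at h
  have h1 := Matrix.rank_of_isUnit _ ((Matrix.isUnit_iff_isUnit_det _).2 (isUnit_iff_ne_zero.2 h))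
  rw [Fintype.card_fin] at h1
  rw [← h1]
  exact Matrix.rank_submatrix_le _ _ _

def baseP (m n l : ℕ) : (Fin m → Fin n → ℂ) × (Fin n → Fin l → ℂ) :=
  (fun i j => if i.val = j.val then 1 else 0, fun i j => if i.val = j.val then 1 else 0)

lemma topMinor_base (m n l : ℕ) (hmax : max m l ≤ n) : topMinor m n l (baseP m n l) = 1 := by
  unfold topMinor
  convert Matrix.det_one (n := Fin (min m l)) (R := ℂ)
  ext i j
  have hi : i.val < n := by omega
  simp only [submatrix_apply, Matrix.mul_apply, Matrix.of_apply, baseP, Fin.val_castLE, Matrix.one_apply]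
  rw [Finset.sum_eq_single ⟨i.val, hi⟩]
  · simp [Fin.ext_iff]
  · intro b _ hb
    have : i.val ≠ b.val := fun h => hb (Fin.ext h.symm)
    simp [this]
  · simp

lemma topMinor_smul (m n l : ℕ) (c : ℂ) (p) :
    topMinor m n l (c • p) = (c * c) ^ (min m l) * topMinor m n l p := by
  unfold topMinor
  have : ((Matrix.of (c • p).1 * Matrix.of (c • p).2).submatrix
    (Fin.castLE (min_le_left m l)) (Fin.castLE (min_le_right m l)))
    = (c * c) • ((Matrix.of p.1 * Matrix.of p.2).submatrix
    (Fin.castLE (min_le_left m l)) (Fin.castLE (min_le_right m l))) := by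
    ext i j
    simp only [submatrix_apply, Matrix.mul_apply, Matrix.of_apply, Prod.smul_fst, Prod.smul_snd,
      Pi.smul_apply, Matrix.smul_apply, smul_eq_mul, Finset.mul_sum]
    exact Finset.sum_congr rfl fun _ _ => by ring
  rw [this, Matrix.det_smul, Fintype.card_fin]

open Polynomial in
lemma exists_poly (m n l : ℕ) (p q : (Fin m → Fin n → ℂ) × (Fin n → Fin l → ℂ)) :
    ∃ r : ℂ[X], ∀ s : ℂ, r.eval s = topMinor m n l (s • p + q) := by
  refine ⟨(((Matrix.of fun i j => X * C (p.1 i j) + C (q.1 i j)) *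
    (Matrix.of fun i j => X * C (p.2 i j) + C (q.2 i j))).submatrix
    (Fin.castLE (min_le_left m l)) (Fin.castLE (min_le_right m l))).det, fun s => ?_⟩
  rw [← Polynomial.coe_evalRingHom, RingHom.map_det]
  unfold topMinor
  congr 1
  ext i j
  simp [Matrix.mul_apply, Polynomial.eval_finsetSum, mul_comm s]

lemma finite_line (m n l : ℕ) (hmax : max m l ≤ n) (p) :
    {t : ℝ | topMinor m n l (p + t • baseP m n l) = 0}.Finite := by
  obtain ⟨r, hr⟩ := exists_poly m n l p (baseP m n l)
  have h0 : r ≠ 0 := by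
    rintro rfl
    have := hr 0
    simp [topMinor_base m n l hmax] at this
  have hf : {s : ℂ | r.IsRoot s}.Finite := Polynomial.finite_setOfPred_isRoot h0
  have hinj : Function.Injective (fun t : ℝ => ((t : ℂ))⁻¹) := fun a b h => by
    simpa using h
  refine ((hf.preimage hinj.injOn).union (Set.finite_singleton (0:ℝ))).subset ?_
  intro t ht
  by_cases h : t = 0
  · right; exact h
  left
  have hc : (t : ℂ) ≠ 0 := by exact_mod_cast h
  have e : p + t • baseP m n l = (t : ℂ) • ((t : ℂ)⁻¹ • p + baseP m n l) := by
    rw [smul_add, smul_inv_smul₀ hc]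
    rfl
  simp only [Set.mem_ofPred_eq] at ht
  rw [e, topMinor_smul, ← hr] at ht
  simpa [hc] using ht

lemma vol_haar (a b : ℕ) : (volume : Measure (Fin a → Fin b → ℂ)).IsAddHaarMeasure := by
  have h : (volume : Measure (Fin b → ℂ)).IsAddHaarMeasure := inferInstance
  exact Measure.pi.isAddHaarMeasure _

/-- For `n ≥ max m l`, the set of pairs `(A, B) ∈ ℂ^{m×n} × ℂ^{n×l}` whose product
fails to have the maximal possible rank `min m l` has Lebesgue measure zero. -/
theorem product_rank_deficient_pairs_measure_zero
    (m n l : ℕ) (hm : 0 < m) (hn : 0 < n) (hl : 0 < l) (hmax : max m l ≤ n) :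
    volume {p : (Fin m → Fin n → ℂ) × (Fin n → Fin l → ℂ) |
      (Matrix.of p.1 * Matrix.of p.2).rank < min m l} = 0 := by
  have h1 := vol_haar m n
  have h2 := vol_haar n l
  have h3 : (volume : Measure ((Fin m → Fin n → ℂ) × (Fin n → Fin l → ℂ))).IsAddHaarMeasure :=
    Measure.prod.instIsAddHaarMeasure _ _
  have key : ∀ᵐ p : (Fin m → Fin n → ℂ) × (Fin n → Fin l → ℂ),
      p ∈ {p | topMinor m n l p ≠ 0} := by
    refine MeasureTheory.ae_mem_of_ae_add_linearMap_mem
      (LinearMap.toSpanSingleton ℝ _ (baseP m n l)) (μ := (volume : Measure ℝ)) volume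
      (((isClosed_singleton.preimage (topMinor_cont m n l)).measurableSet).compl) ?_
    intro p
    have := (finite_line m n l hmax p).measure_zero volume
    rw [ae_iff]
    simpa [LinearMap.toSpanSingleton_apply] using this
  refine measure_mono_null ?_ (ae_iff.1 key)
  intro p hp hne
  exact absurd (rank_of_topMinor m n l p hne) (not_le.2 hp)
end

section
/- Let n, m, γ be positive integers with m < n and γm ≤ n. The set of γ-tuples (B₁, …, B_γ) ∈ (ℂ^{n×(n−m)})^γ for which the dimension of the intersection of the column spaces, dim( colspan(B₁) ∩ ⋯ ∩ colspan(B_γ) ), is not equal to n − γm has Lebesgue measure zero, where (ℂ^{n×(n−m)})^γ is identified with a real Euclidean space and equipped with Lebesgue measure. -/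
open MeasureTheory Matrix

theorem gid_ae_ne {E : Type*} [NormedAddCommGroup E] [NormedSpace ℝ E] [FiniteDimensional ℝ E]
    [MeasurableSpace E] [BorelSpace E] (μ : Measure E) [μ.IsAddHaarMeasure]
    (F : E → ℂ) (hF : Continuous F) (v0 : E)
    (h : ∀ x, ∀ᵐ t : ℝ, F (v0 + t • x) ≠ 0) : ∀ᵐ x ∂μ, F x ≠ 0 := by
  have h1 : ∀ᵐ x ∂μ, ∀ᵐ t : ℝ, F (v0 + t • x) ≠ 0 := Filter.Eventually.of_forall h
  have hmeas : MeasurableSet {p : E × ℝ | F (v0 + p.2 • p.1) ≠ 0} := by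
    have : Continuous fun p : E × ℝ => F (v0 + p.2 • p.1) := by fun_prop
    exact (isOpen_ne_fun this continuous_const).measurableSet
  have h2 := (Measure.ae_ae_comm (μ := μ) (ν := (volume : Measure ℝ))
    (p := fun x t => F (v0 + t • x) ≠ 0) hmeas).1 h1
  have h3 : ∀ᵐ t : ℝ, t ≠ 0 := by
    simp [ae_iff]
  obtain ⟨t, ht, ht0⟩ := (h2.and h3).exists
  rw [ae_iff] at ht ⊢
  simp only [not_not] at ht ⊢
  have h4 := Measure.addHaar_preimage_smul μ ht0 ((fun x => v0 + x) ⁻¹' {x | F x = 0})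
  have h5 : (fun x => t • x) ⁻¹' ((fun x => v0 + x) ⁻¹' {x | F x = 0}) =
    {a | F (v0 + t • a) = 0} := rfl
  rw [measure_preimage_add] at h4
  have h6 : μ {a | F (v0 + t • a) = 0} = _ := h4
  rw [ht] at h6
  rcases mul_eq_zero.1 h6.symm with h7 | h7
  · exfalso
    rw [ENNReal.ofReal_eq_zero] at h7
    have : 0 < |(t ^ Module.finrank ℝ E)⁻¹| := by positivity
    linarith
  · exact h7

theorem gid_ae_det {E : Type*} [NormedAddCommGroup E] [NormedSpace ℝ E] [FiniteDimensional ℝ E]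
    [MeasurableSpace E] [BorelSpace E] (μ : Measure E) [μ.IsAddHaarMeasure]
    {ι : Type*} [Fintype ι] [DecidableEq ι]
    (A : E → Matrix ι ι ℂ) (hA : Continuous A) (v0 : E) (A1 : E → Matrix ι ι ℂ)
    (h1 : ∀ x (t : ℝ), A (v0 + t • x) = A v0 + (t : ℂ) • A1 x)
    (h0 : (A v0).det ≠ 0) : ∀ᵐ x ∂μ, (A x).det ≠ 0 := by
  refine gid_ae_ne μ (fun x => (A x).det) hA.matrix_det v0 fun x => ?_
  let p : Polynomial ℂ := ((A v0).map Polynomial.C +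
    (Polynomial.X : Polynomial ℂ) • (A1 x).map Polynomial.C).det
  have hp : ∀ t : ℂ, p.eval t = (A v0 + t • A1 x).det := by
    intro t
    change (Polynomial.evalRingHom t) p = _
    rw [RingHom.map_det]
    congr 1
    ext i j
    simp
    ring
  have hp0 : p ≠ 0 := by
    intro hp'
    have := hp 0
    rw [hp'] at this
    simp at this
    exact h0 this.symm
  have hfin : {t : ℝ | p.eval (t : ℂ) = 0}.Finite := by
    have h2 := (p.rootSet_finite ℂ).preimage (f := ((↑) : ℝ → ℂ))
      Complex.ofReal_injective.injOn
    refine h2.subset fun t ht => ?_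
    rw [Set.mem_preimage, Polynomial.mem_rootSet]
    exact ⟨hp0, by simpa using ht⟩
  rw [ae_iff]
  refine measure_mono_null ?_ (hfin.measure_zero volume)
  intro t ht
  simp only [not_not, Set.mem_ofPred_eq] at ht ⊢
  rw [hp, ← h1, ht]

/-- The matrix of `(y, x) ↦ (y - B i x i)_i`. -/
def gidPhi {n k γ : ℕ} (B : Fin γ → Fin n → Fin k → ℂ) :
    Matrix (Fin γ × Fin n) (Fin n ⊕ Fin γ × Fin k) ℂ :=
  Matrix.of fun p q => Sum.elim (fun s => if p.2 = s then 1 else 0)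
    (fun jc => if p.1 = jc.1 then - B p.1 p.2 jc.2 else 0) q

theorem gidPhi_mulVec {n k γ : ℕ} (B : Fin γ → Fin n → Fin k → ℂ)
    (v : Fin n ⊕ Fin γ × Fin k → ℂ) (i : Fin γ) (r : Fin n) :
    (gidPhi B *ᵥ v) (i, r) =
      v (Sum.inl r) - (Matrix.of (B i) *ᵥ fun c => v (Sum.inr (i, c))) r := by
  simp [gidPhi, Matrix.mulVec, dotProduct, Fintype.sum_prod_type, sub_eq_add_neg,
    Finset.sum_neg_distrib, ite_mul]

theorem gid_finrank {n k γ : ℕ} (B : Fin γ → Fin n → Fin k → ℂ)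
    (hs : Function.Surjective (gidPhi B).mulVec)
    (hi : ∀ i, Function.Injective (Matrix.of (B i)).mulVec) :
    Module.finrank ℂ ↥(⨅ i, LinearMap.range (Matrix.of (B i)).mulVecLin) + γ * n
      = n + γ * k := by
  let K := LinearMap.ker (gidPhi B).mulVecLin
  have hmem : ∀ v, v ∈ K ↔ ∀ i, (Matrix.of (B i) *ᵥ fun c => v (Sum.inr (i, c))) =
      fun r => v (Sum.inl r) := by
    intro v
    rw [LinearMap.mem_ker, Matrix.mulVecLin_apply]
    constructor
    · intro h i
      ext r
      have := congrFun h (i, r)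
      rw [gidPhi_mulVec] at this
      exact (sub_eq_zero.1 this).symm
    · intro h
      ext ⟨i, r⟩
      rw [gidPhi_mulVec, h i]
      simp
  let g := (LinearMap.funLeft ℂ ℂ (Sum.inl : Fin n → Fin n ⊕ Fin γ × Fin k)).domRestrict K
  have hg : Function.Injective g := by
    rw [injective_iff_map_eq_zero]
    rintro ⟨v, hv⟩ h
    have hl : ∀ r, v (Sum.inl r) = 0 := fun r => congrFun h r
    rw [hmem] at hv
    apply Subtype.ext
    ext q
    rcases q with r | ⟨i, c⟩
    · exact hl r
    · have h2 := hv i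
      have h3 : (fun c => v (Sum.inr (i, c))) = 0 := by
        apply hi i
        change (Matrix.of (B i) *ᵥ fun c => v (Sum.inr (i, c))) = Matrix.of (B i) *ᵥ 0
        rw [h2, Matrix.mulVec_zero]
        ext r
        exact hl r
      exact congrFun h3 c
  have hr : LinearMap.range g = ⨅ i, LinearMap.range (Matrix.of (B i)).mulVecLin := by
    ext y
    simp only [Submodule.mem_iInf, LinearMap.mem_range]
    constructor
    · rintro ⟨⟨v, hv⟩, rfl⟩ i
      rw [hmem] at hv
      exact ⟨_, hv i⟩
    · intro h
      choose x hx using h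
      refine ⟨⟨Sum.elim y fun p => x p.1 p.2, ?_⟩, ?_⟩
      · rw [hmem]
        intro i
        exact hx i
      · rfl
  have h1 := LinearMap.finrank_range_of_inj hg
  rw [hr] at h1
  have h2 := LinearMap.finrank_range_add_finrank_ker (gidPhi B).mulVecLin
  rw [LinearMap.range_eq_top.2 hs] at h2
  simp at h2
  rw [h1]
  change γ * n + Module.finrank ℂ K = _ at h2
  omega

set_option maxHeartbeats 2000000 in
theorem generic_intersection_dimension
    (n m γ : ℕ) (hn : 0 < n) (hm : 0 < m) (hγ : 0 < γ)
    (hmn : m < n) (hγm : γ * m ≤ n) :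
    volume {B : Fin γ → Fin n → Fin (n - m) → ℂ |
      Module.finrank ℂ
          ↥(⨅ i, LinearMap.range (Matrix.of (B i)).mulVecLin) ≠ n - γ * m} = 0 := by
  -- the witness
  have hlt : ∀ i : Fin γ, (i : ℕ) * m + m ≤ n := fun i => by
    have : ((i : ℕ) + 1) * m ≤ γ * m := Nat.mul_le_mul_right _ i.2
    rw [add_mul, one_mul] at this
    omega
  let σ : Fin γ → Fin (n - m) → Fin n := fun i c =>
    ⟨if (c : ℕ) < i * m then c else c + m, by split_ifs <;> omega⟩
  have hσ : ∀ i, Function.Injective (σ i) := by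
    intro i c d h
    have h' := congrArg Fin.val h
    simp only [σ] at h'
    ext
    split_ifs at h' <;> omega
  have hσ' : ∀ (i : Fin γ) (r : Fin n), (r : ℕ) / m ≠ i → ∃ c, σ i c = r := by
    intro i r hr
    have h1 : ¬ ((i : ℕ) * m ≤ r ∧ (r : ℕ) < i * m + m) := by
      rintro ⟨h1, h2⟩
      apply hr
      apply Nat.div_eq_of_lt_le h1
      rw [add_mul, one_mul]
      exact h2
    have := r.2
    have := hlt i
    by_cases h : (r : ℕ) < i * m
    · refine ⟨⟨r, by omega⟩, ?_⟩
      ext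
      simp [σ, h]
    · refine ⟨⟨r - m, by omega⟩, ?_⟩
      ext
      simp only [σ]
      split_ifs <;> omega
  let B0 : Fin γ → Fin n → Fin (n - m) → ℂ := fun i r c => if r = σ i c then 1 else 0
  have hL : ∀ i, (Matrix.of (B0 i))ᵀ * Matrix.of (B0 i) = 1 := by
    intro i
    ext c d
    simp [B0, Matrix.mul_apply, Matrix.one_apply, (hσ i).eq_iff, eq_comm]
  have hS : Function.Surjective (gidPhi B0).mulVec := by
    intro z
    let y : Fin n → ℂ := fun r => if h : (r : ℕ) / m < γ then z (⟨r / m, h⟩, r) else 0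
    refine ⟨Sum.elim y fun p => y (σ p.1 p.2) - z (p.1, σ p.1 p.2), ?_⟩
    ext ⟨i, r⟩
    rw [gidPhi_mulVec]
    simp only [Sum.elim_inl, Sum.elim_inr]
    by_cases hr : (r : ℕ) / m = i
    · have hne : ∀ c, r ≠ σ i c := by
        intro c hc
        have h1 := congrArg Fin.val hc
        simp only [σ] at h1
        have h2 : (i : ℕ) * m ≤ r := by rw [← hr]; exact Nat.div_mul_le_self _ _
        have h3 : (r : ℕ) < i * m + m := by
          rw [← hr]; exact Nat.lt_div_mul_add hm
        split_ifs at h1 <;> omega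
      have hy : y r = z (i, r) := by
        simp [y, hr]
      simp [Matrix.mulVec, dotProduct, B0, hne, hy]
    · obtain ⟨c, rfl⟩ := hσ' i r hr
      simp [Matrix.mulVec, dotProduct, B0, (hσ i).eq_iff]
  obtain ⟨R, hR⟩ := Matrix.mulVec_surjective_iff_exists_right_inverse.1 hS
  have haar1 : (volume : Measure (Fin (n - m) → ℂ)).IsAddHaarMeasure := inferInstance
  have haar2 : (volume : Measure (Fin n → Fin (n - m) → ℂ)).IsAddHaarMeasure :=
    Measure.pi.isAddHaarMeasure _
  have haar3 : (volume : Measure (Fin γ → Fin n → Fin (n - m) → ℂ)).IsAddHaarMeasure :=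
    Measure.pi.isAddHaarMeasure _
  have ae1 : ∀ᵐ B : Fin γ → Fin n → Fin (n - m) → ℂ, (gidPhi B * R).det ≠ 0 := by
    refine gid_ae_det volume (fun B => gidPhi B * R) ?_ B0 (fun X => (gidPhi X - gidPhi 0) * R)
      ?_ ?_
    · refine Continuous.matrix_mul ?_ continuous_const
      refine continuous_matrix fun p q => ?_
      rcases q with s | ⟨j, c⟩
      · simp only [gidPhi, Matrix.of_apply, Sum.elim_inl]
        exact continuous_const
      · simp only [gidPhi, Matrix.of_apply, Sum.elim_inr]
        split_ifs <;> fun_prop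
    · intro X t
      rw [← Matrix.smul_mul, ← Matrix.add_mul]
      congr 1
      ext p q
      rcases q with s | ⟨j, c⟩
      · simp [gidPhi]
      · simp only [gidPhi, Matrix.of_apply, Sum.elim_inr, Matrix.add_apply, Matrix.smul_apply,
          Matrix.sub_apply]
        split_ifs
        · simp
          ring
        · simp
    · simp [hR]
  have ae2 : ∀ i, ∀ᵐ B : Fin γ → Fin n → Fin (n - m) → ℂ,
      ((Matrix.of (B0 i))ᵀ * Matrix.of (B i)).det ≠ 0 := by
    intro i
    refine gid_ae_det volume (fun B => (Matrix.of (B0 i))ᵀ * Matrix.of (B i)) ?_ B0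
      (fun X => (Matrix.of (B0 i))ᵀ * Matrix.of (X i)) ?_ ?_
    · refine Continuous.matrix_mul continuous_const ?_
      refine continuous_matrix fun p q => ?_
      simp only [Matrix.of_apply]
      fun_prop
    · intro X t
      rw [← Matrix.mul_smul, ← Matrix.mul_add]
      congr 1
    · simp [hL]
  have key : ∀ᵐ B : Fin γ → Fin n → Fin (n - m) → ℂ, Module.finrank ℂ
          ↥(⨅ i, LinearMap.range (Matrix.of (B i)).mulVecLin) = n - γ * m := by
    filter_upwards [ae1, ae_all_iff.2 ae2] with B h1 h2
    have hs : Function.Surjective (gidPhi B).mulVec := by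
      rw [Matrix.mulVec_surjective_iff_exists_right_inverse]
      refine ⟨R * (gidPhi B * R)⁻¹, ?_⟩
      rw [← Matrix.mul_assoc]
      exact Matrix.mul_nonsing_inv _ (isUnit_iff_ne_zero.2 h1)
    have hi : ∀ i, Function.Injective (Matrix.of (B i)).mulVec := by
      intro i x y hxy
      have hxy' : Matrix.of (B i) *ᵥ x = Matrix.of (B i) *ᵥ y := hxy
      have h3 := congrArg (fun v => (Matrix.of (B0 i))ᵀ *ᵥ v) hxy'
      simp only [Matrix.mulVec_mulVec] at h3
      exact Matrix.mulVec_injective_iff_isUnit.2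
        ((Matrix.isUnit_iff_isUnit_det _).2 (isUnit_iff_ne_zero.2 (h2 i))) h3
    have h4 := gid_finrank B hs hi
    have h5 : γ * n = γ * (n - m) + γ * m := by
      rw [← mul_add, Nat.sub_add_cancel hmn.le]
    omega
  simpa [ae_iff] using key
end

section
/- Let L ≥ 2 and K ≥ 2 be integers and let γ be an integer with 1 ≤ γ ≤ K − 1. Then ((L−1)γ + 1)(K + 1 − γ) ≥ LK, with equality when γ = 1. -/
/-- Concavity bound for the antenna count of generalized null space interference
alignment: for `L ≥ 2`, `K ≥ 2` and `1 ≤ γ ≤ K − 1`,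
`((L−1)γ + 1)(K + 1 − γ) ≥ LK`, with equality when `γ = 1`. -/
theorem phi_ge_LK
    (L K γ : ℕ) (hL : 2 ≤ L) (hK : 2 ≤ K) (hγ1 : 1 ≤ γ) (hγK : γ ≤ K - 1) :
    L * K ≤ ((L - 1) * γ + 1) * (K + 1 - γ) ∧
    ((L - 1) * 1 + 1) * (K + 1 - 1) = L * K := by
  obtain ⟨a, rfl⟩ := Nat.exists_eq_add_of_le hL
  obtain ⟨g, rfl⟩ := Nat.exists_eq_add_of_le hγ1
  obtain ⟨d, rfl⟩ : ∃ d, K = g + 2 + d := ⟨K - (g + 2), by omega⟩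
  have h1 : 2 + a - 1 = a + 1 := by omega
  have h2 : g + 2 + d + 1 - (1 + g) = d + 2 := by omega
  have h3 : g + 2 + d + 1 - 1 = g + 2 + d := by omega
  rw [h1, h2, h3]
  constructor
  · have h : ((a + 1) * (1 + g) + 1) * (d + 2)
        = (2 + a) * (g + 2 + d) + g * (a * d + a + d) := by ring
    rw [h]
    exact Nat.le_add_right _ _
  · ring
end

section
/- Let L ≥ 2 and K ≥ 1 be integers. For each integer γ with 1 ≤ γ ≤ K, define M(γ) = (K − γ) + 1, and define N(γ) = (L−1)γ·M(γ) + 1 if 1 ≤ γ ≤ K−1 and N(K) = (L−1)K·M(K) + K. Then M(γ) + N(γ) ≥ LK + 1 for every such γ, and equality holds at γ = 1 and at γ = K. -/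
/-- The generalized null space interference alignment scheme with one stream per user
(`β = 1`) always satisfies the necessary condition `M + N ≥ LK + 1`, with equality at
geometric multiplicity `γ = 1` and `γ = K`. Here `M(γ) = (K − γ) + 1` and
`N(γ) = (L−1)γM(γ) + 1` for `1 ≤ γ ≤ K−1`, while `N(K) = (L−1)K·M(K) + K`. -/
theorem null_space_IA_satisfies_necessary_condition
    (L K : ℕ) (hL : 2 ≤ L) (hK : 1 ≤ K)
    (M N : ℕ → ℕ)
    (hM : ∀ γ, M γ = (K - γ) + 1)
    (hN : ∀ γ, N γ = if γ = K then (L - 1) * K * M K + K else (L - 1) * γ * M γ + 1) :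
    (∀ γ, 1 ≤ γ → γ ≤ K → L * K + 1 ≤ M γ + N γ) ∧
    M 1 + N 1 = L * K + 1 ∧ M K + N K = L * K + 1 := by
  obtain ⟨l, rfl⟩ : ∃ l, L = l + 2 := ⟨L - 2, by omega⟩
  have e : l + 2 - 1 = l + 1 := by omega
  have hKK : M K + N K = (l + 2) * K + 1 := by
    rw [hN K, if_pos rfl, hM K, e, Nat.sub_self]
    ring
  have key : ∀ a d, K = (a + 1) + (d + 1) →
      M (a + 1) + N (a + 1) = (l + 2) * K + 1 + a * ((l + 1) * d + l) := by
    intro a d h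
    have h1 : K - (a + 1) = d + 1 := by omega
    rw [hN, if_neg (by omega), hM, e, h1, h]
    ring
  refine ⟨?_, ?_, hKK⟩
  · intro γ h1 h2
    rcases Nat.eq_or_lt_of_le h2 with h | h
    · rw [h, hKK]
    · obtain ⟨a, rfl⟩ : ∃ a, γ = a + 1 := ⟨γ - 1, by omega⟩
      rw [key a (K - (a + 1) - 1) (by omega)]
      exact Nat.le_add_right _ _
  · rcases Nat.eq_or_lt_of_le hK with h | h
    · rw [← h] at hKK
      rw [← h]
      exact hKK
    · have := key 0 (K - 2) (by omega)
      simpa using this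
end
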